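/- arXiv:1402.0080 — 2 statements merged into one kernel-verified Lean document; each statement's English description precedes it below -/
import Mathlib

section
/- For every homogeneous set A, the Hausdorff dimension of A equals the lower box-counting dimension of A, and both equal liminf_{r→0} α_A(r). -/
open scoped ENNReal

noncomputable section

open Filter MeasureTheory

/-- A compact set `A` is *homogeneous* with respect to the Borel probability measure `μ`
supported on `A` and constants `lam ≥ 1`, `kappa ∈ (0,1)`, `1 < del ≤ Del`. -/
structure IsHomog {X : Type*} [MetricSpace X] [MeasurableSpace X]
    (A : Set X) (μ : Measure X) (lam kappa del Del : ℝ) : Prop where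
  compact : IsCompact A
  diam_pos : 0 < Metric.diam A
  prob : IsProbabilityMeasure μ
  supp_null : μ Aᶜ = 0
  supp_pos : ∀ x ∈ A, ∀ r : ℝ, 0 < r → 0 < μ (Metric.closedBall x r)
  one_le_lam : 1 ≤ lam
  ratio_le : ∀ x₁ ∈ A, ∀ x₂ ∈ A, ∀ r : ℝ, 0 < r → r ≤ Metric.diam A →
    (μ (Metric.closedBall x₁ r)).toReal ≤ lam * (μ (Metric.closedBall x₂ r)).toReal
  kappa_pos : 0 < kappa
  kappa_lt_one : kappa < 1
  one_lt_del : 1 < del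
  del_le_Del : del ≤ Del
  scale_lower : ∀ x ∈ A, ∀ r : ℝ, 0 < r → r ≤ Metric.diam A →
    del * (μ (Metric.closedBall x (kappa * r))).toReal ≤ (μ (Metric.closedBall x r)).toReal
  scale_upper : ∀ x ∈ A, ∀ r : ℝ, 0 < r → r ≤ Metric.diam A →
    (μ (Metric.closedBall x r)).toReal ≤ Del * (μ (Metric.closedBall x (kappa * r))).toReal

/-- `alphaPt μ x r = log μ(B(x,r)) / log r`. -/
def alphaPt {X : Type*} [MetricSpace X] [MeasurableSpace X]
    (μ : Measure X) (x : X) (r : ℝ) : ℝ :=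
  Real.log (μ (Metric.closedBall x r)).toReal / Real.log r

/-- `g ∼ h` : `|h r - g r| = O(1/|log r|)` as `r → 0⁺`. -/
def EquivNearZero (g h : ℝ → ℝ) : Prop :=
  ∃ C : ℝ, 0 < C ∧ ∃ δ : ℝ, 0 < δ ∧ ∀ r : ℝ, 0 < r → r < δ → |h r - g r| ≤ C / |Real.log r|

/-- `g` is a representative of the equivalence class `[α_A(x,·)]` of the homogeneous set `A`. -/
def IsAlphaRep {X : Type*} [MetricSpace X] [MeasurableSpace X]
    (A : Set X) (μ : Measure X) (g : ℝ → ℝ) : Prop :=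
  ∃ x ∈ A, EquivNearZero g (fun r => alphaPt μ x r)

/-- `χ(A,B)` computed from representatives `g` of `[α_A]` and `h` of `[α_B]`. -/
def chiFun (g h : ℝ → ℝ) : ℝ :=
  Filter.limsup (fun r => |Real.log (g r / h r)|) (nhdsWithin (0 : ℝ) (Set.Ioi 0))

/-- `N(A,r)`: the smallest number of closed balls of radius `r` needed to cover `A`. -/
def coverNum {X : Type*} [MetricSpace X] (A : Set X) (r : ℝ) : ℕ :=
  sInf {m : ℕ | ∃ s : Finset X, s.card = m ∧ A ⊆ ⋃ x ∈ s, Metric.closedBall x r}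

/-- Lower box-counting dimension. -/
def lowerBoxDim {X : Type*} [MetricSpace X] (A : Set X) : ℝ :=
  Filter.liminf (fun r : ℝ => Real.log (coverNum A r : ℝ) / (-Real.log r))
    (nhdsWithin (0 : ℝ) (Set.Ioi 0))

/-- Upper box-counting dimension. -/
def upperBoxDim {X : Type*} [MetricSpace X] (A : Set X) : ℝ :=
  Filter.limsup (fun r : ℝ => Real.log (coverNum A r : ℝ) / (-Real.log r))
    (nhdsWithin (0 : ℝ) (Set.Ioi 0))

/-- Radius-based packing premeasure. -/
def packPre {X : Type*} [MetricSpace X] (A : Set X) (s : ℝ) : ℝ≥0∞ :=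
  ⨅ (δ : ℝ) (_ : 0 < δ),
    ⨆ (m : ℕ) (x : Fin m → X) (ρ : Fin m → ℝ) (_ : ∀ i, x i ∈ A)
      (_ : ∀ i, 0 < ρ i ∧ ρ i ≤ δ)
      (_ : ∀ i j, i ≠ j →
        Disjoint (Metric.closedBall (x i) (ρ i)) (Metric.closedBall (x j) (ρ j))),
      ∑ i, ENNReal.ofReal (ρ i ^ s)

/-- Radius-based packing measure. -/
def packMeasure {X : Type*} [MetricSpace X] (A : Set X) (s : ℝ) : ℝ≥0∞ :=
  ⨅ (F : ℕ → Set X) (_ : A ⊆ ⋃ m, F m), ∑' m, packPre (F m) s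

/-- Radius-based packing dimension. -/
def packDim {X : Type*} [MetricSpace X] (A : Set X) : ℝ :=
  sInf {s : ℝ | 0 ≤ s ∧ packMeasure A s = 0}

/-- Distance between two sets, valued in `ℝ≥0∞`. -/
def setDistE {X : Type*} [MetricSpace X] (E F : Set X) : ℝ≥0∞ :=
  ⨅ (a : X) (_ : a ∈ E) (b : X) (_ : b ∈ F), edist a b

/-- Uniformly disconnected set. -/
def UnifDisconn {X : Type*} [MetricSpace X] (A : Set X) : Prop :=
  ∃ C : ℝ, 1 < C ∧ ∃ rstar : ℝ, 0 < rstar ∧ ∀ x ∈ A, ∀ r : ℝ, 0 < r → r < rstar →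
    ∃ E : Set X, E ⊆ A ∧ A ∩ Metric.closedBall x r ⊆ E ∧
      E ⊆ Metric.closedBall x (C * r) ∧ ENNReal.ofReal r < setDistE E (A \ E)

/-- `A` can be bilipschitz embedded into `B`. -/
def BilipEmbed {X Y : Type*} [MetricSpace X] [MetricSpace Y] (A : Set X) (B : Set Y) : Prop :=
  ∃ (f : X → Y) (L : ℝ), 1 ≤ L ∧ Set.MapsTo f A B ∧ Set.InjOn f A ∧
    ∀ x₁ ∈ A, ∀ x₂ ∈ A,
      dist x₁ x₂ / L ≤ dist (f x₁) (f x₂) ∧ dist (f x₁) (f x₂) ≤ L * dist x₁ x₂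

/-- `A` and `B` are bilipschitz equivalent. -/
def BilipEquivSets {X Y : Type*} [MetricSpace X] [MetricSpace Y] (A : Set X) (B : Set Y) :
    Prop :=
  ∃ (f : X → Y) (L : ℝ), 1 ≤ L ∧ Set.BijOn f A B ∧
    ∀ x₁ ∈ A, ∀ x₂ ∈ A,
      dist x₁ x₂ / L ≤ dist (f x₁) (f x₂) ∧ dist (f x₁) (f x₂) ≤ L * dist x₁ x₂

/-- `A` and `B` are quasi-Lipschitz equivalent. -/
def QuasiLipEquiv {X Y : Type*} [MetricSpace X] [MetricSpace Y] (A : Set X) (B : Set Y) : Prop :=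
  ∃ f : X → Y, Set.BijOn f A B ∧
    ∀ ε : ℝ, 0 < ε → ∃ δ : ℝ, 0 < δ ∧ ∀ x₁ ∈ A, ∀ x₂ ∈ A,
      0 < dist x₁ x₂ → dist x₁ x₂ < δ →
      |Real.log (dist (f x₁) (f x₂)) / Real.log (dist x₁ x₂) - 1| < ε

/-- Ahlfors–David `s`-regular set. -/
def IsADRegular {X : Type*} [MetricSpace X] [MeasurableSpace X] (A : Set X) (s : ℝ) : Prop :=
  IsCompact A ∧ 0 < Metric.diam A ∧
    ∃ (μ : Measure X) (c : ℝ), 1 ≤ c ∧ μ Aᶜ = 0 ∧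
      ∀ x ∈ A, ∀ r : ℝ, 0 < r → r ≤ Metric.diam A →
        ENNReal.ofReal (c⁻¹ * r ^ s) ≤ μ (Metric.closedBall x r) ∧
          μ (Metric.closedBall x r) ≤ ENNReal.ofReal (c * r ^ s)

/-- `n₁ ⋯ n_k` (with `0`-based indexing of the sequence `n`). -/
def prodN (n : ℕ → ℕ) (k : ℕ) : ℕ := ∏ i ∈ Finset.range k, n i

/-- `c₁ ⋯ c_k` (with `0`-based indexing of the sequence `c`). -/
def prodC (c : ℕ → ℝ) (k : ℕ) : ℝ := ∏ i ∈ Finset.range k, c i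

/-- Admissible word for the branching sequence `n`. -/
def AdmWord (n : ℕ → ℕ) (w : List ℕ) : Prop := ∀ i : Fin w.length, w.get i < n i.val

/-- A Moran structure on `J ⊆ ℝ^d` with branching numbers `n` and ratios `c`:
`Jw w` is the basic set indexed by the word `w`. -/
structure IsMoranSystem {d : ℕ} (J : Set (EuclideanSpace ℝ (Fin d))) (n : ℕ → ℕ)
    (c : ℕ → ℝ) (Jw : List ℕ → Set (EuclideanSpace ℝ (Fin d))) : Prop where
  compact : IsCompact J
  int_nonempty : (interior J).Nonempty
  two_le_n : ∀ k, 2 ≤ n k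
  c_pos : ∀ k, 0 < c k
  c_lt_one : ∀ k, c k < 1
  c_inf_pos : ∃ c₀ : ℝ, 0 < c₀ ∧ ∀ k, c₀ ≤ c k
  root : Jw [] = J
  subset : ∀ w : List ℕ, AdmWord n w → ∀ i : ℕ, i < n w.length → Jw (w ++ [i]) ⊆ Jw w
  similar : ∀ w : List ℕ, AdmWord n w → ∀ i : ℕ, i < n w.length →
    ∃ S : EuclideanSpace ℝ (Fin d) → EuclideanSpace ℝ (Fin d),
      (∀ x y, dist (S x) (S y) = c w.length * dist x y) ∧ Jw (w ++ [i]) = S '' Jw w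
  disj_int : ∀ w : List ℕ, AdmWord n w → ∀ i : ℕ, i < n w.length → ∀ j : ℕ, j < n w.length →
    i ≠ j → Disjoint (interior (Jw (w ++ [i]))) (interior (Jw (w ++ [j])))

/-- The Moran set determined by the family `Jw`. -/
def moranSet {d : ℕ} (n : ℕ → ℕ) (Jw : List ℕ → Set (EuclideanSpace ℝ (Fin d))) :
    Set (EuclideanSpace ℝ (Fin d)) :=
  ⋂ k : ℕ, ⋃ (w : List ℕ) (_ : w.length = k ∧ AdmWord n w), Jw w

/-- The index `k` such that `(c₁⋯c_k)·D < r ≤ (c₁⋯c_{k-1})·D`. -/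
def levelOf (c : ℕ → ℝ) (D r : ℝ) : ℕ := sInf {k : ℕ | prodC c k * D < r}

/-- `Φ(r) = n₁⋯n_k` whenever `(c₁⋯c_k)·D < r ≤ (c₁⋯c_{k-1})·D`, where `D = |J|`. -/
def Phi (n : ℕ → ℕ) (c : ℕ → ℝ) (D r : ℝ) : ℕ := prodN n (levelOf c D r)

/-- A perturbation tending to zero does not increase the lower limit of a bounded function. -/
theorem liminf_le_liminf_of_le_add_of_tendsto_zero {ι : Type*} {l : Filter ι} {f g e : ι → ℝ}
    (hf : l.IsBoundedUnder (· ≥ ·) f) (hg : l.IsCoboundedUnder (· ≥ ·) g)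
    (he : Tendsto e l (nhds 0)) (h : ∀ᶠ i in l, f i ≤ g i + e i) :
    liminf f l ≤ liminf g l := by
  refine le_of_forall_pos_le_add fun ε hε => ?_
  have h1 : ∀ᶠ i in l, liminf f l - ε / 2 < f i :=
    eventually_lt_of_lt_liminf (by linarith) hf
  have h2 : ∀ᶠ i in l, e i < ε / 2 := he.eventually_lt_const (by linarith)
  have h3 : liminf f l - ε ≤ liminf g l := by
    refine le_liminf_of_le hg ?_
    filter_upwards [h, h1, h2] with i a b c
    linarith
  linarith

/-- Two functions at asymptotic distance zero, one of them bounded, have the same lower limit. -/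
theorem liminf_eq_of_abs_sub_le_of_tendsto_zero {ι : Type*} {l : Filter ι} [l.NeBot]
    {f g e : ι → ℝ} {a b : ℝ} (hf : ∀ᶠ i in l, a ≤ f i ∧ f i ≤ b)
    (he : Tendsto e l (nhds 0)) (h : ∀ᶠ i in l, |f i - g i| ≤ e i) :
    liminf g l = liminf f l := by
  have hg : ∀ᶠ i in l, a - 1 ≤ g i ∧ g i ≤ b + 1 := by
    filter_upwards [hf, h, he.eventually_lt_const one_pos] with i hi h1 h2
    have := abs_le.1 h1
    constructor <;> linarith [hi.1, hi.2, this.1, this.2]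
  have hfb : l.IsBoundedUnder (· ≥ ·) f := ⟨a, eventually_map.2 (hf.mono fun _ h => h.1)⟩
  have hgb : l.IsBoundedUnder (· ≥ ·) g := ⟨a - 1, eventually_map.2 (hg.mono fun _ h => h.1)⟩
  have hfu : l.IsBoundedUnder (· ≤ ·) f := ⟨b, eventually_map.2 (hf.mono fun _ h => h.2)⟩
  have hgu : l.IsBoundedUnder (· ≤ ·) g := ⟨b + 1, eventually_map.2 (hg.mono fun _ h => h.2)⟩
  apply le_antisymm
  · refine liminf_le_liminf_of_le_add_of_tendsto_zero hgb hfu.isCoboundedUnder_ge he ?_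
    filter_upwards [h] with i hi
    linarith [(abs_le.1 hi).1]
  · refine liminf_le_liminf_of_le_add_of_tendsto_zero hfb hgu.isCoboundedUnder_ge he ?_
    filter_upwards [h] with i hi
    linarith [(abs_le.1 hi).2]

theorem tendsto_const_div_neg_log (C : ℝ) :
    Tendsto (fun r : ℝ => C / (-Real.log r)) (nhdsWithin 0 (Set.Ioi 0)) (nhds 0) :=
  (tendsto_neg_atBot_atTop.comp Real.tendsto_log_nhdsGT_zero).const_div_atTop C

/-- A compact set has a cover realising `coverNum`. -/
theorem exists_cover_card_eq_coverNum {X : Type*} [MetricSpace X] {A : Set X}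
    (hA : IsCompact A) {r : ℝ} (hr : 0 < r) :
    ∃ s : Finset X, s.card = coverNum A r ∧ A ⊆ ⋃ x ∈ s, Metric.closedBall x r := by
  refine Nat.sInf_mem
    (s := {m : ℕ | ∃ s : Finset X, s.card = m ∧ A ⊆ ⋃ x ∈ s, Metric.closedBall x r}) ?_
  obtain ⟨t, -, ht, hAt⟩ := hA.finite_cover_balls hr
  refine ⟨ht.toFinset.card, ht.toFinset, rfl, hAt.trans ?_⟩
  simp only [Set.Finite.mem_toFinset]
  exact Set.iUnion₂_mono fun x _ => Metric.ball_subset_closedBall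

/-- If all finite `r`-separated subsets of `A` have at most `B` elements, then `coverNum A r` is
bounded by the cardinality of one of them. -/
theorem exists_separated_coverNum_le_card {X : Type*} [MetricSpace X] {A : Set X} {r : ℝ} {B : ℕ}
    (hB : ∀ s : Finset X, (s : Set X) ⊆ A →
      (s : Set X).Pairwise (fun x y => r < dist x y) → s.card ≤ B) (hr : 0 < r) :
    ∃ s : Finset X, (s : Set X) ⊆ A ∧ (s : Set X).Pairwise (fun x y => r < dist x y) ∧
      coverNum A r ≤ s.card := by
  classical
  let T : Set ℕ := {n | ∃ s : Finset X, (s : Set X) ⊆ A ∧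
    (s : Set X).Pairwise (fun x y => r < dist x y) ∧ s.card = n}
  have hT : BddAbove T := ⟨B, by rintro n ⟨s, h1, h2, rfl⟩; exact hB s h1 h2⟩
  obtain ⟨s, h1, h2, h3⟩ : sSup T ∈ T := Nat.sSup_mem ⟨0, ∅, by simp⟩ hT
  refine ⟨s, h1, h2, Nat.sInf_le ⟨s, rfl, fun x hx => ?_⟩⟩
  by_contra hcov
  simp only [Set.mem_iUnion, Metric.mem_closedBall, not_exists, not_le] at hcov
  have hxs : x ∉ s := fun h => by
    have := hcov x h
    rw [dist_self] at this
    linarith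
  have hmem : s.card + 1 ∈ T := by
    refine ⟨insert x s, ?_, ?_, Finset.card_insert_of_notMem hxs⟩
    · rw [Finset.coe_insert]
      exact Set.insert_subset hx h1
    · rw [Finset.coe_insert]
      refine h2.insert fun y hy _ => ⟨hcov y hy, ?_⟩
      rw [dist_comm]
      exact hcov y hy
  have := le_csSup hT hmem
  omega

namespace IsHomog

variable {X : Type*} [MetricSpace X] [MeasurableSpace X] {A : Set X} {μ : Measure X}
  {lam kappa del Del : ℝ}

theorem toReal_pos (hA : IsHomog A μ lam kappa del Del) {x : X} (hx : x ∈ A) {r : ℝ}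
    (hr : 0 < r) : 0 < (μ (Metric.closedBall x r)).toReal := by
  have := hA.prob
  exact ENNReal.toReal_pos (hA.supp_pos x hx r hr).ne' (measure_ne_top _ _)

theorem toReal_le_one (hA : IsHomog A μ lam kappa del Del) (s : Set X) :
    (μ s).toReal ≤ 1 := by
  have := hA.prob
  exact measureReal_le_one

theorem measure_self (hA : IsHomog A μ lam kappa del Del) : μ A = 1 := by
  have := hA.prob
  rw [measure_of_measure_compl_eq_zero hA.supp_null, measure_univ]

theorem toReal_mono (hA : IsHomog A μ lam kappa del Del) {s t : Set X} (h : s ⊆ t) :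
    (μ s).toReal ≤ (μ t).toReal := by
  have := hA.prob
  exact measureReal_mono h

theorem Del_pos (hA : IsHomog A μ lam kappa del Del) : 0 < Del := by
  linarith [hA.one_lt_del, hA.del_le_Del]

theorem toReal_le_pow_mul (hA : IsHomog A μ lam kappa del Del) {x : X} (hx : x ∈ A) {r : ℝ}
    (hr : 0 < r) (hrD : r ≤ Metric.diam A) (n : ℕ) :
    (μ (Metric.closedBall x r)).toReal ≤
      Del ^ n * (μ (Metric.closedBall x (kappa ^ n * r))).toReal := by
  induction n with
  | zero => simp
  | succ n ih =>
    have hk := hA.kappa_pos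
    have h1 : kappa ^ n * r ≤ Metric.diam A :=
      (mul_le_of_le_one_left hr.le (pow_le_one₀ hk.le hA.kappa_lt_one.le)).trans hrD
    have h2 := hA.scale_upper x hx (kappa ^ n * r) (by positivity) h1
    have h3 : kappa * (kappa ^ n * r) = kappa ^ (n + 1) * r := by ring
    rw [h3] at h2
    calc _ ≤ _ := ih
      _ ≤ Del ^ n * (Del * (μ (Metric.closedBall x (kappa ^ (n + 1) * r))).toReal) :=
        mul_le_mul_of_nonneg_left h2 (pow_nonneg hA.Del_pos.le n)
      _ = _ := by ring

/-- The measure of a homogeneous set is doubling. -/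
theorem exists_toReal_le_mul (hA : IsHomog A μ lam kappa del Del) {c : ℝ} (hc : 0 < c) :
    ∃ K : ℝ, 0 < K ∧ ∀ x ∈ A, ∀ r : ℝ, 0 < r → r ≤ Metric.diam A →
      (μ (Metric.closedBall x r)).toReal ≤ K * (μ (Metric.closedBall x (c * r))).toReal := by
  obtain ⟨n, hn⟩ := exists_pow_lt_of_lt_one hc hA.kappa_lt_one
  have := hA.Del_pos
  refine ⟨Del ^ n, by positivity, fun x hx r hr hrD => ?_⟩
  refine (hA.toReal_le_pow_mul hx hr hrD n).trans
    (mul_le_mul_of_nonneg_left (hA.toReal_mono (Metric.closedBall_subset_closedBall ?_))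
      (by positivity))
  gcongr

/-- Balls centred in a homogeneous set have at least polynomial measure. -/
theorem exists_rpow_le_toReal (hA : IsHomog A μ lam kappa del Del) {x : X} (hx : x ∈ A) :
    ∃ c t : ℝ, 0 < c ∧ ∀ r : ℝ, 0 < r → r ≤ Metric.diam A →
      c * r ^ t ≤ (μ (Metric.closedBall x r)).toReal := by
  have hk := hA.kappa_pos
  have hD := hA.diam_pos
  have hDel := hA.Del_pos
  set t : ℝ := Real.log Del / (-Real.log kappa) with ht
  have hlk : Real.log kappa < 0 := Real.log_neg hk hA.kappa_lt_one
  have ht0 : 0 ≤ t := div_nonneg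
    (Real.log_nonneg (by linarith [hA.one_lt_del, hA.del_le_Del])) (by linarith)
  have hkt : kappa ^ t = Del⁻¹ := by
    rw [Real.rpow_def_of_pos hk, ht, ← Real.exp_log hDel, ← Real.exp_neg, Real.log_exp]
    congr 1
    have := hlk.ne
    field_simp
  set m := (μ (Metric.closedBall x (Metric.diam A))).toReal with hm
  have hm0 : 0 < m := hA.toReal_pos hx hD
  refine ⟨m * Del⁻¹ * (Metric.diam A ^ t)⁻¹, t, by positivity, fun r hr hrD => ?_⟩
  obtain ⟨n, hn1, hn2⟩ := exists_nat_pow_near_of_lt_one (x := r / Metric.diam A) (by positivity)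
    ((div_le_one hD).2 hrD) hk hA.kappa_lt_one
  have h1 := hA.toReal_le_pow_mul hx hD le_rfl (n + 1)
  have h2 := hA.toReal_mono (Metric.closedBall_subset_closedBall (x := x)
    ((lt_div_iff₀ hD).1 hn1).le)
  have h3 : (r / Metric.diam A) ^ t ≤ (Del ^ n)⁻¹ := by
    calc _ ≤ (kappa ^ n) ^ t := Real.rpow_le_rpow (by positivity) hn2 ht0
      _ = (kappa ^ t) ^ n := by
        rw [← Real.rpow_natCast, ← Real.rpow_mul hk.le, mul_comm, Real.rpow_mul hk.le,
          Real.rpow_natCast]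
      _ = _ := by rw [hkt, inv_pow]
  rw [Real.div_rpow hr.le hD.le] at h3
  calc m * Del⁻¹ * (Metric.diam A ^ t)⁻¹ * r ^ t
      = m * Del⁻¹ * (r ^ t / Metric.diam A ^ t) := by ring
    _ ≤ m * Del⁻¹ * (Del ^ n)⁻¹ := by gcongr
    _ = m / Del ^ (n + 1) := by rw [pow_succ]; field_simp
    _ ≤ _ := by
      rw [div_le_iff₀ (by positivity), mul_comm]
      exact h1.trans (by gcongr)

theorem eventually_alphaPt_mem (hA : IsHomog A μ lam kappa del Del) {x : X} (hx : x ∈ A) :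
    ∃ b : ℝ, ∀ᶠ r in nhdsWithin (0 : ℝ) (Set.Ioi 0), 0 ≤ alphaPt μ x r ∧ alphaPt μ x r ≤ b := by
  obtain ⟨c, t, hc, h⟩ := hA.exists_rpow_le_toReal hx
  refine ⟨t + 1, ?_⟩
  filter_upwards [self_mem_nhdsWithin, Ioo_mem_nhdsGT one_pos, Ioo_mem_nhdsGT hA.diam_pos,
    (tendsto_const_div_neg_log (-Real.log c)).eventually_lt_const one_pos] with r hr hr1 hrD h1
  have hr : 0 < r := hr
  have hl : Real.log r < 0 := Real.log_neg hr hr1.2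
  refine ⟨div_nonneg_of_nonpos
    (Real.log_nonpos (hA.toReal_pos hx hr).le (hA.toReal_le_one _)) hl.le, ?_⟩
  have h2 := Real.log_le_log (by positivity) (h r hr hrD.2.le)
  rw [Real.log_mul hc.ne' (by positivity), Real.log_rpow hr] at h2
  rw [div_lt_one (by linarith)] at h1
  rw [alphaPt, div_le_iff_of_neg hl]
  nlinarith

/-- The covering number is at most a constant over the measure of a ball. -/
theorem exists_coverNum_mul_le [BorelSpace X] (hA : IsHomog A μ lam kappa del Del) {x : X}
    (hx : x ∈ A) :
    ∃ C : ℝ, 0 < C ∧ ∀ r : ℝ, 0 < r → r ≤ Metric.diam A →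
      coverNum A r * (μ (Metric.closedBall x r)).toReal ≤ C := by
  have := hA.prob
  obtain ⟨K, hK, hdoub⟩ := hA.exists_toReal_le_mul (c := 1 / 3) (by norm_num)
  have hlam : 0 < lam := by linarith [hA.one_le_lam]
  refine ⟨lam * K, by positivity, fun r hr hrD => ?_⟩
  have hm := hA.toReal_pos hx hr
  have key : ∀ s : Finset X, (s : Set X) ⊆ A →
      (s : Set X).Pairwise (fun x y => r < dist x y) →
      s.card * (μ (Metric.closedBall x r)).toReal ≤ lam * K := by
    intro s hs hsep
    have hdisj : (s : Set X).PairwiseDisjoint fun y => Metric.closedBall y (1 / 3 * r) := by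
      intro y hy z hz hyz
      refine Metric.closedBall_disjoint_closedBall ?_
      linarith [hsep hy hz hyz]
    have hsum : ∑ y ∈ s, (μ (Metric.closedBall y (1 / 3 * r))).toReal ≤ 1 := by
      have := measureReal_biUnion_finset (μ := μ) hdisj
        (fun y _ => Metric.isClosed_closedBall.measurableSet)
      exact this.symm.trans_le (hA.toReal_le_one _)
    calc s.card * (μ (Metric.closedBall x r)).toReal
        = ∑ y ∈ s, (μ (Metric.closedBall x r)).toReal := by simp
      _ ≤ ∑ y ∈ s, lam * K * (μ (Metric.closedBall y (1 / 3 * r))).toReal := by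
        refine Finset.sum_le_sum fun y hy => ?_
        rw [mul_assoc]
        exact (hA.ratio_le x hx y (hs hy) r hr hrD).trans
          (mul_le_mul_of_nonneg_left (hdoub y (hs hy) r hr hrD) hlam.le)
      _ = lam * K * ∑ y ∈ s, (μ (Metric.closedBall y (1 / 3 * r))).toReal := by
        rw [Finset.mul_sum]
      _ ≤ lam * K := mul_le_of_le_one_right (by positivity) hsum
  obtain ⟨s, h1, h2, h3⟩ := exists_separated_coverNum_le_card (A := A) (r := r)
    (B := ⌊lam * K / (μ (Metric.closedBall x r)).toReal⌋₊)
    (fun s h1 h2 => Nat.le_floor ((le_div_iff₀ hm).2 (key s h1 h2))) hr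
  refine le_trans ?_ (key s h1 h2)
  gcongr

/-- The covering number is at least a constant over the measure of a ball. -/
theorem exists_one_le_coverNum_mul (hA : IsHomog A μ lam kappa del Del) {x : X}
    (hx : x ∈ A) :
    ∃ C : ℝ, 0 < C ∧ ∀ r : ℝ, 0 < r → r ≤ Metric.diam A / 2 →
      1 ≤ C * (coverNum A r * (μ (Metric.closedBall x r)).toReal) := by
  have := hA.prob
  obtain ⟨K, hK, hdoub⟩ := hA.exists_toReal_le_mul (c := 1 / 2) (by norm_num)
  have hlam : 0 < lam := by linarith [hA.one_le_lam]
  refine ⟨lam * K, by positivity, fun r hr hrD => ?_⟩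
  obtain ⟨s, hs, hcov⟩ := exists_cover_card_eq_coverNum hA.compact hr
  have hball : ∀ y, (μ (Metric.closedBall y r)).toReal ≤
      lam * K * (μ (Metric.closedBall x r)).toReal := by
    intro y
    by_cases hy : ∃ z ∈ A, z ∈ Metric.closedBall y r
    · obtain ⟨z, hz, hzy⟩ := hy
      have h1 : Metric.closedBall y r ⊆ Metric.closedBall z (2 * r) := by
        refine Metric.closedBall_subset_closedBall' ?_
        rw [Metric.mem_closedBall, dist_comm] at hzy
        linarith
      have h2 := hdoub x hx (2 * r) (by linarith) (by linarith)
      rw [show 1 / 2 * (2 * r) = r by ring] at h2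
      rw [mul_assoc]
      exact (hA.toReal_mono h1).trans ((hA.ratio_le z hz x hx (2 * r) (by linarith)
        (by linarith)).trans (mul_le_mul_of_nonneg_left h2 hlam.le))
    · have : μ (Metric.closedBall y r) = 0 :=
        measure_mono_null (fun z hz hzA => hy ⟨z, hzA, hz⟩) hA.supp_null
      rw [this, ENNReal.toReal_zero]
      positivity
  calc (1 : ℝ) = (μ A).toReal := by rw [hA.measure_self, ENNReal.toReal_one]
    _ ≤ (μ (⋃ y ∈ s, Metric.closedBall y r)).toReal := hA.toReal_mono hcov
    _ ≤ ∑ y ∈ s, (μ (Metric.closedBall y r)).toReal := measureReal_biUnion_finset_le s _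
    _ ≤ ∑ y ∈ s, lam * K * (μ (Metric.closedBall x r)).toReal :=
      Finset.sum_le_sum fun y _ => hball y
    _ = _ := by rw [Finset.sum_const, nsmul_eq_mul, hs]; ring

theorem lowerBoxDim_eq_liminf_alphaPt [BorelSpace X] (hA : IsHomog A μ lam kappa del Del) {x : X}
    (hx : x ∈ A) :
    lowerBoxDim A = liminf (alphaPt μ x) (nhdsWithin (0 : ℝ) (Set.Ioi 0)) := by
  obtain ⟨b, hb⟩ := hA.eventually_alphaPt_mem hx
  obtain ⟨C, hC, hup⟩ := hA.exists_coverNum_mul_le hx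
  obtain ⟨C', hC', hlow⟩ := hA.exists_one_le_coverNum_mul hx
  have hD := hA.diam_pos
  refine liminf_eq_of_abs_sub_le_of_tendsto_zero hb
    (tendsto_const_div_neg_log (max (Real.log C) (Real.log C'))) ?_
  filter_upwards [self_mem_nhdsWithin, Ioo_mem_nhdsGT one_pos,
    Ioo_mem_nhdsGT (half_pos hD)] with r hr hr1 hrD
  have hr : 0 < r := hr
  have hl : Real.log r < 0 := Real.log_neg hr hr1.2
  have hm := hA.toReal_pos hx hr
  have h1 := hup r hr (by linarith [hrD.2])
  have h2 := hlow r hr hrD.2.le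
  have hN : (0 : ℝ) < coverNum A r := by
    rcases (Nat.cast_nonneg (α := ℝ) (coverNum A r)).eq_or_lt with h | h
    · rw [← h] at h2
      norm_num at h2
    · exact h
  have h1' := Real.log_le_log (by positivity) h1
  have h2' := Real.log_le_log one_pos h2
  rw [Real.log_mul hN.ne' hm.ne'] at h1'
  rw [Real.log_one, Real.log_mul hC'.ne' (by positivity), Real.log_mul hN.ne' hm.ne'] at h2'
  have : alphaPt μ x r - Real.log (coverNum A r) / (-Real.log r) =
      (-(Real.log (coverNum A r) + Real.log (μ (Metric.closedBall x r)).toReal)) /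
        (-Real.log r) := by
    rw [alphaPt]
    have := hl.ne
    field_simp
    ring
  rw [this, abs_div, abs_of_pos (a := -Real.log r) (by linarith), abs_neg]
  refine div_le_div_of_nonneg_right (abs_le.2 ⟨?_, ?_⟩) (by linarith)
  · linarith [le_max_right (Real.log C) (Real.log C')]
  · linarith [le_max_left (Real.log C) (Real.log C')]

theorem dimH_le_of_liminf_alphaPt_lt [BorelSpace X] (hA : IsHomog A μ lam kappa del Del) {x : X}
    (hx : x ∈ A) {s : NNReal}
    (hs : liminf (alphaPt μ x) (nhdsWithin (0 : ℝ) (Set.Ioi 0)) < s) : dimH A ≤ s := by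
  obtain ⟨b, hb⟩ := hA.eventually_alphaPt_mem hx
  obtain ⟨C, hC, hup⟩ := hA.exists_coverNum_mul_le hx
  have hcob : (nhdsWithin (0 : ℝ) (Set.Ioi 0)).IsCoboundedUnder (· ≥ ·) (alphaPt μ x) :=
    IsBoundedUnder.isCoboundedUnder_ge ⟨b, eventually_map.2 (hb.mono fun _ h => h.2)⟩
  have hfreq := frequently_lt_of_liminf_lt hcob hs
  have hex : ∀ r : ℝ, ∃ F : Finset X, 0 < r →
      F.card = coverNum A r ∧ A ⊆ ⋃ x ∈ F, Metric.closedBall x r := by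
    intro r
    by_cases hr : 0 < r
    · obtain ⟨F, hF⟩ := exists_cover_card_eq_coverNum hA.compact hr
      exact ⟨F, fun _ => hF⟩
    · exact ⟨∅, fun h => absurd h hr⟩
  choose F hF using hex
  have hpos : ∀ᶠ r : ℝ in nhdsWithin 0 (Set.Ioi 0), 0 < r := self_mem_nhdsWithin
  refine dimH_le_of_hausdorffMeasure_ne_top (ne_top_of_le_ne_top
    (ENNReal.ofReal_ne_top (r := C * 2 ^ (s : ℝ))) ?_)
  have ht : Tendsto (fun r : ℝ => ENNReal.ofReal (2 * r)) (nhdsWithin 0 (Set.Ioi 0)) (nhds 0) := by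
    have : Tendsto (fun r : ℝ => ENNReal.ofReal (2 * r)) (nhds 0)
        (nhds (ENNReal.ofReal (2 * 0))) :=
      (ENNReal.continuous_ofReal.comp (continuous_const.mul continuous_id)).tendsto 0
    rw [mul_zero, ENNReal.ofReal_zero] at this
    exact this.mono_left nhdsWithin_le_nhds
  have hdiam : ∀ (y : X) (r : ℝ), Metric.ediam (Metric.closedBall y r) ≤
      ENNReal.ofReal (2 * r) := by
    intro y r
    refine Metric.ediam_le fun z hz w hw => ?_
    rw [edist_dist]
    refine ENNReal.ofReal_le_ofReal ?_
    linarith [dist_triangle_right z w y, Metric.mem_closedBall.1 hz, Metric.mem_closedBall.1 hw]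
  refine (Measure.hausdorffMeasure_le_liminf_sum (s : ℝ) A (fun r : ℝ => ENNReal.ofReal (2 * r))
    ht (fun (r : ℝ) (y : F r) => Metric.closedBall (y : X) r)
    (Eventually.of_forall fun r y => hdiam y r) ?_).trans ?_
  · filter_upwards [hpos] with r hr
    have := (hF r hr).2
    rwa [Set.iUnion_subtype]
  · refine liminf_le_of_frequently_le' ((hfreq.and_eventually
      (inter_mem hpos (inter_mem (Ioo_mem_nhdsGT one_pos) (Ioo_mem_nhdsGT hA.diam_pos)))).mono ?_)
    rintro r ⟨hα, hr, hr1, hrD⟩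
    replace hr : 0 < r := hr
    have hl : Real.log r < 0 := Real.log_neg hr hr1.2
    have hm := hA.toReal_pos hx hr
    have h1 : r ^ (s : ℝ) ≤ (μ (Metric.closedBall x r)).toReal := by
      rw [alphaPt, div_lt_iff_of_neg hl, ← Real.log_rpow hr] at hα
      exact ((Real.log_lt_log_iff (by positivity) hm).1 hα).le
    calc ∑ y : F r, Metric.ediam (Metric.closedBall (y : X) r) ^ (s : ℝ)
        ≤ ∑ y : F r, ENNReal.ofReal (2 * r) ^ (s : ℝ) := by
          gcongr with y
          exact hdiam y r
      _ = ENNReal.ofReal (coverNum A r * (2 * r) ^ (s : ℝ)) := by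
        rw [Finset.sum_const, Finset.card_univ, Fintype.card_coe, (hF r hr).1, nsmul_eq_mul,
          ENNReal.ofReal_rpow_of_nonneg (by positivity) (by positivity),
          ENNReal.ofReal_mul (by positivity), ENNReal.ofReal_natCast]
      _ ≤ _ := by
        refine ENNReal.ofReal_le_ofReal ?_
        rw [Real.mul_rpow (by norm_num) hr.le]
        calc (coverNum A r : ℝ) * (2 ^ (s : ℝ) * r ^ (s : ℝ))
            = coverNum A r * r ^ (s : ℝ) * 2 ^ (s : ℝ) := by ring
          _ ≤ coverNum A r * (μ (Metric.closedBall x r)).toReal * 2 ^ (s : ℝ) := by gcongr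
          _ ≤ _ := by
            gcongr
            exact hup r hr hrD.2.le

theorem le_dimH_of_lt_liminf_alphaPt [BorelSpace X] (hA : IsHomog A μ lam kappa del Del) {x : X}
    (hx : x ∈ A) {s : NNReal} (hs0 : 0 < s)
    (hs : s < liminf (alphaPt μ x) (nhdsWithin (0 : ℝ) (Set.Ioi 0))) : s ≤ dimH A := by
  have := hA.prob
  obtain ⟨b, hb⟩ := hA.eventually_alphaPt_mem hx
  have hlam : 0 < lam := by linarith [hA.one_le_lam]
  have hs0' : (0 : ℝ) < s := hs0
  have hbdd : (nhdsWithin (0 : ℝ) (Set.Ioi 0)).IsBoundedUnder (· ≥ ·) (alphaPt μ x) :=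
    ⟨0, eventually_map.2 (hb.mono fun _ h => h.1)⟩
  have hev := eventually_lt_of_lt_liminf hs hbdd
  obtain ⟨ε, hε, hsmall⟩ : ∃ ε : ℝ, 0 < ε ∧ ∀ r : ℝ, 0 < r → r ≤ ε → ∀ y ∈ A,
      (μ (Metric.closedBall y r)).toReal ≤ lam * r ^ (s : ℝ) := by
    obtain ⟨ε, hε, h⟩ := mem_nhdsGT_iff_exists_Ioc_subset.1
      (inter_mem hev (inter_mem (Ioo_mem_nhdsGT one_pos) (Ioo_mem_nhdsGT hA.diam_pos)))
    refine ⟨ε, hε, fun r hr hrε y hy => ?_⟩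
    obtain ⟨hα, hr1, hrD⟩ := h ⟨hr, hrε⟩
    replace hα : s < alphaPt μ x r := hα
    have hl : Real.log r < 0 := Real.log_neg hr hr1.2
    have hm := hA.toReal_pos hx hr
    rw [alphaPt, lt_div_iff_of_neg hl, ← Real.log_rpow hr] at hα
    exact (hA.ratio_le y hy x hx r hr hrD.2.le).trans (mul_le_mul_of_nonneg_left
      ((Real.log_lt_log_iff hm (by positivity)).1 hα).le hlam.le)
  have hsmall' : ∀ r : ℝ, 0 < r → r ≤ ε → ∀ y ∈ A,
      μ (Metric.closedBall y r) ≤ ENNReal.ofReal lam * ENNReal.ofReal r ^ (s : ℝ) := by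
    intro r hr hrε y hy
    rw [ENNReal.ofReal_rpow_of_pos hr, ← ENNReal.ofReal_mul hlam.le]
    exact (ENNReal.le_ofReal_iff_toReal_le (measure_ne_top _ _) (by positivity)).2
      (hsmall r hr hrε y hy)
  have hl0 : ENNReal.ofReal lam ≠ 0 := by simpa using hlam
  have hle : (ENNReal.ofReal lam)⁻¹ • μ ≤ Measure.hausdorffMeasure (s : ℝ) := by
    refine Measure.le_hausdorffMeasure _ _ (ENNReal.ofReal ε) (by simpa using hε) fun U hU => ?_
    rw [Measure.smul_apply, smul_eq_mul, mul_comm, ← div_eq_mul_inv]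
    refine ENNReal.div_le_of_le_mul' ?_
    by_cases hne : ∃ y ∈ A, y ∈ U
    · obtain ⟨y, hyA, hyU⟩ := hne
      have hfin : Metric.ediam U ≠ ⊤ := ne_top_of_le_ne_top ENNReal.ofReal_ne_top hU
      set ρ := (Metric.ediam U).toReal with hρ
      have hUρ : Metric.ediam U = ENNReal.ofReal ρ := (ENNReal.ofReal_toReal hfin).symm
      have hρε : ρ ≤ ε := by
        rw [hUρ] at hU
        exact (ENNReal.ofReal_le_ofReal_iff hε.le).1 hU
      have hsub : ∀ r, ρ ≤ r → U ⊆ Metric.closedBall y r := fun r hr z hz => by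
        rw [Metric.mem_closedBall, dist_edist]
        exact (ENNReal.toReal_mono hfin (Metric.edist_le_ediam_of_mem hz hyU)).trans hr
      have hρ0 : 0 ≤ ρ := ENNReal.toReal_nonneg
      rcases hρ0.eq_or_lt with h0 | h0
      · have hlim : Tendsto (fun r : ℝ => ENNReal.ofReal lam * ENNReal.ofReal r ^ (s : ℝ))
            (nhdsWithin 0 (Set.Ioi 0)) (nhds 0) := by
          have h1 : Continuous fun r : ℝ => ENNReal.ofReal lam * ENNReal.ofReal r ^ (s : ℝ) :=
            (ENNReal.continuous_const_mul ENNReal.ofReal_ne_top).comp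
              (ENNReal.continuous_rpow_const.comp ENNReal.continuous_ofReal)
          have h2 := h1.tendsto 0
          rw [ENNReal.ofReal_zero, ENNReal.zero_rpow_of_pos hs0', mul_zero] at h2
          exact h2.mono_left nhdsWithin_le_nhds
        have : μ U ≤ 0 := by
          refine ge_of_tendsto hlim ?_
          filter_upwards [Ioc_mem_nhdsGT hε] with r hr
          exact (measure_mono (hsub r (by linarith [hr.1]))).trans (hsmall' r hr.1 hr.2 y hyA)
        exact this.trans zero_le
      · rw [hUρ]
        exact (measure_mono (hsub ρ le_rfl)).trans (hsmall' ρ h0 hρε y hyA)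
    · have : μ U = 0 := measure_mono_null (fun z hz hzA => hne ⟨z, hzA, hz⟩) hA.supp_null
      rw [this]
      exact zero_le
  refine le_dimH_of_hausdorffMeasure_ne_zero fun h0 => ?_
  have h1 := hle A
  rw [h0, Measure.smul_apply, hA.measure_self, smul_eq_mul, mul_one] at h1
  exact ENNReal.inv_ne_zero.2 ENNReal.ofReal_ne_top (le_antisymm h1 zero_le)

theorem dimH_eq_liminf_alphaPt [BorelSpace X] (hA : IsHomog A μ lam kappa del Del) {x : X}
    (hx : x ∈ A) :
    dimH A = ENNReal.ofReal (liminf (alphaPt μ x) (nhdsWithin (0 : ℝ) (Set.Ioi 0))) := by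
  apply le_antisymm
  · refine ENNReal.le_of_forall_pos_le_add fun ε hε _ => ?_
    have := hA.dimH_le_of_liminf_alphaPt_lt hx
      (s := (liminf (alphaPt μ x) (nhdsWithin (0 : ℝ) (Set.Ioi 0))).toNNReal + ε) (by
        have h1 := Real.le_coe_toNNReal
          (liminf (alphaPt μ x) (nhdsWithin (0 : ℝ) (Set.Ioi 0)))
        have h2 : (0 : ℝ) < ε := hε
        push_cast
        linarith)
    rwa [ENNReal.coe_add] at this
  · refine ENNReal.le_of_forall_nnreal_lt fun s hs => ?_
    rcases eq_zero_or_pos s with rfl | hs0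
    · simp
    · refine hA.le_dimH_of_lt_liminf_alphaPt hx hs0 ?_
      exact Real.lt_toNNReal_iff_coe_lt.1 (ENNReal.coe_lt_coe.1 hs)

end IsHomog

/-- For a homogeneous set `A`, the Hausdorff dimension equals the lower box-counting
dimension, and both equal `liminf_{r→0} α_A(r)`. -/
theorem statement1 {X : Type*} [MetricSpace X] [MeasurableSpace X] [BorelSpace X]
    (A : Set X) (μ : Measure X) (lam kappa del Del : ℝ)
    (hA : IsHomog A μ lam kappa del Del) (g : ℝ → ℝ) (hg : IsAlphaRep A μ g) :
    dimH A = ENNReal.ofReal (Filter.liminf g (nhdsWithin (0 : ℝ) (Set.Ioi 0))) ∧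
      lowerBoxDim A = Filter.liminf g (nhdsWithin (0 : ℝ) (Set.Ioi 0)) := by
  obtain ⟨x, hx, C, -, δ, hδ, hgx⟩ := hg
  obtain ⟨b, hb⟩ := hA.eventually_alphaPt_mem hx
  have hlim : liminf g (nhdsWithin (0 : ℝ) (Set.Ioi 0)) =
      liminf (alphaPt μ x) (nhdsWithin (0 : ℝ) (Set.Ioi 0)) := by
    refine liminf_eq_of_abs_sub_le_of_tendsto_zero hb (tendsto_const_div_neg_log C) ?_
    filter_upwards [Ioo_mem_nhdsGT one_pos, Ioo_mem_nhdsGT hδ] with r hr1 hr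
    rw [← abs_of_neg (Real.log_neg hr1.1 hr1.2)]
    exact hgx r hr.1 hr.2
  rw [hlim]
  exact ⟨hA.dimH_eq_liminf_alphaPt hx, hA.lowerBoxDim_eq_liminf_alphaPt hx⟩

end
end

section
/- Every Moran set E ∈ M(J,{n_k},{c_k}) (with inf_k c_k > 0) is homogeneous. Moreover, one can take α_E(r) = log(n₁⋯n_k)/(−log(c₁⋯c_k)) for (c₁⋯c_k)|J| < r ≤ (c₁⋯c_{k−1})|J|. -/
open scoped ENNReal

noncomputable section

open Filter MeasureTheory

open scoped Pointwise in
theorem volume_image_similarity {d : ℕ}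
    {S : EuclideanSpace ℝ (Fin d) → EuclideanSpace ℝ (Fin d)} {a : ℝ} (ha : 0 < a)
    (hS : ∀ x y, dist (S x) (S y) = a * dist x y) (A : Set (EuclideanSpace ℝ (Fin d))) :
    volume.real (interior (S '' A)) = a ^ d * volume.real (interior A) := by
  have hT : Isometry fun x => a⁻¹ • S x := Isometry.of_dist_eq fun x y => by
    rw [dist_smul₀, hS, Real.norm_of_nonneg (inv_nonneg.2 ha.le), inv_mul_cancel_left₀ ha.ne']
  let e := hT.affineIsometryOfStrictConvexSpace.toAffineIsometryEquiv rfl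
  have he : ∀ x, e x = a⁻¹ • S x := fun x => rfl
  have hA : S '' A = a • (e '' A) := by
    rw [← Set.image_smul, Set.image_image]
    simp only [he, smul_inv_smul₀ ha.ne']
  have hint : interior (e '' A) = e '' interior A := (e.toHomeomorph.image_interior A).symm
  rw [hA, interior_smul₀ ha.ne', hint, Measure.real, Measure.addHaar_smul, finrank_euclideanSpace,
    Fintype.card_fin, ENNReal.toReal_mul, abs_of_pos (by positivity),
    ENNReal.toReal_ofReal (by positivity), Measure.real,
    ← EuclideanSpace.euclideanHausdorffMeasure_eq_volume, e.isometry.euclideanHausdorffMeasure_image]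

/-- Words of length `k` whose `i`-th letter is smaller than `n i`. -/
abbrev MoranWord (n : ℕ → ℕ) (k : ℕ) : Type := ∀ i : Fin k, Fin (n i)

namespace MoranWord

variable {n : ℕ → ℕ} {k : ℕ}

/-- The list of letters of a word. -/
def toList (t : MoranWord n k) : List ℕ := List.ofFn fun i => (t i : ℕ)

/-- The word without its last letter. -/
def dropLast (t : MoranWord n (k + 1)) : MoranWord n k := fun i => t i.castSucc

@[simp]
theorem length_toList (t : MoranWord n k) : t.toList.length = k := List.length_ofFn

/-- The first `k` letters of an infinite word. -/
def ofSeq (σ : ∀ i, Fin (n i)) (k : ℕ) : MoranWord n k := fun i => σ i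

theorem toList_succ (t : MoranWord n (k + 1)) :
    t.toList = t.dropLast.toList ++ [(t (Fin.last k) : ℕ)] := List.ofFn_succ_last

theorem admWord (t : MoranWord n k) : AdmWord n t.toList := by
  intro i
  have hi : (i : ℕ) < k := i.isLt.trans_eq t.length_toList
  have : t.toList.get i = t ⟨i, hi⟩ := List.get_ofFn _ i
  exact this ▸ (t ⟨i, hi⟩).isLt

theorem exists_toList_eq {w : List ℕ} (hw : AdmWord n w) :
    ∃ t : MoranWord n w.length, t.toList = w :=
  ⟨fun i => ⟨w.get i, hw i⟩, List.ofFn_get w⟩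

end MoranWord

theorem moranSet_eq {d : ℕ} (n : ℕ → ℕ) (Jw : List ℕ → Set (EuclideanSpace ℝ (Fin d))) :
    moranSet n Jw = ⋂ k : ℕ, ⋃ t : MoranWord n k, Jw t.toList := by
  refine Set.iInter_congr fun k => Set.Subset.antisymm ?_ ?_
  · refine Set.iUnion₂_subset ?_
    rintro w ⟨rfl, hw⟩
    obtain ⟨t, ht⟩ := MoranWord.exists_toList_eq hw
    exact Set.subset_iUnion_of_subset t (by rw [ht])
  · exact Set.iUnion_subset fun t =>
      Set.subset_iUnion₂_of_subset t.toList ⟨t.length_toList, t.admWord⟩ subset_rfl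

theorem prodC_succ (c : ℕ → ℝ) (k : ℕ) : prodC c (k + 1) = prodC c k * c k :=
  Finset.prod_range_succ c k

theorem prodN_succ (n : ℕ → ℕ) (k : ℕ) : prodN n (k + 1) = prodN n k * n k :=
  Finset.prod_range_succ n k

theorem prodC_zero (c : ℕ → ℝ) : prodC c 0 = 1 := Finset.prod_range_zero c

theorem prodN_zero (n : ℕ → ℕ) : prodN n 0 = 1 := Finset.prod_range_zero n

namespace IsMoranSystem

open MoranWord

variable {d : ℕ} {J : Set (EuclideanSpace ℝ (Fin d))} {n : ℕ → ℕ} {c : ℕ → ℝ}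
  {Jw : List ℕ → Set (EuclideanSpace ℝ (Fin d))} (h : IsMoranSystem J n c Jw)

include h

theorem prodC_pos (k : ℕ) : 0 < prodC c k := Finset.prod_pos fun i _ => h.c_pos i

theorem toList_zero (t : MoranWord n 0) : Jw t.toList = J := h.root

theorem subset_dropLast {k : ℕ} (t : MoranWord n (k + 1)) : Jw t.toList ⊆ Jw t.dropLast.toList := by
  rw [toList_succ]
  exact h.subset _ t.dropLast.admWord _ (by simp)

theorem exists_similarity {k : ℕ} (t : MoranWord n (k + 1)) :
    ∃ S : EuclideanSpace ℝ (Fin d) → EuclideanSpace ℝ (Fin d),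
      (∀ x y, dist (S x) (S y) = c k * dist x y) ∧ Jw t.toList = S '' Jw t.dropLast.toList := by
  obtain ⟨S, hS, hS'⟩ := h.similar _ t.dropLast.admWord (t (Fin.last k)) (by simp)
  refine ⟨S, by simpa using hS, ?_⟩
  rw [toList_succ, hS']

theorem disjoint_interior {k : ℕ} {t u : MoranWord n k} (htu : t ≠ u) :
    Disjoint (interior (Jw t.toList)) (interior (Jw u.toList)) := by
  induction k with
  | zero => exact (htu (Subsingleton.elim _ _)).elim
  | succ k ih =>
    by_cases hdrop : t.dropLast = u.dropLast
    · have hlast : (t (Fin.last k) : ℕ) ≠ u (Fin.last k) := by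
        intro hl
        refine htu (funext fun i => ?_)
        induction i using Fin.lastCases with
        | last => exact Fin.ext hl
        | cast i => exact congrFun hdrop i
      have := h.disj_int _ t.dropLast.admWord _ (by simp) _ (by simp) hlast
      rwa [toList_succ t, toList_succ u, ← hdrop]
    · exact (ih hdrop).mono (interior_mono (h.subset_dropLast t)) (interior_mono (h.subset_dropLast u))

theorem volume_interior {k : ℕ} (t : MoranWord n k) :
    volume.real (interior (Jw t.toList)) = prodC c k ^ d * volume.real (interior J) := by
  induction k with
  | zero => rw [h.toList_zero, prodC_zero, one_pow, one_mul]
  | succ k ih =>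
    obtain ⟨S, hS, hS'⟩ := h.exists_similarity t
    rw [hS', volume_image_similarity (h.c_pos k) hS, ih, prodC_succ]
    ring

theorem dist_le {k : ℕ} (t : MoranWord n k) {x y : EuclideanSpace ℝ (Fin d)}
    (hx : x ∈ Jw t.toList) (hy : y ∈ Jw t.toList) : dist x y ≤ prodC c k * Metric.diam J := by
  induction k generalizing x y with
  | zero =>
    rw [h.toList_zero] at hx hy
    rw [prodC_zero, one_mul]
    exact Metric.dist_le_diam_of_mem h.compact.isBounded hx hy
  | succ k ih =>
    obtain ⟨S, hS, hS'⟩ := h.exists_similarity t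
    rw [hS'] at hx hy
    obtain ⟨x, hx, rfl⟩ := hx
    obtain ⟨y, hy, rfl⟩ := hy
    rw [hS, prodC_succ, mul_right_comm, mul_comm (c k)]
    exact mul_le_mul_of_nonneg_right (ih _ hx hy) (h.c_pos k).le

theorem isCompact_nonempty {k : ℕ} (t : MoranWord n k) :
    IsCompact (Jw t.toList) ∧ (Jw t.toList).Nonempty := by
  induction k with
  | zero =>
    rw [h.toList_zero]
    exact ⟨h.compact, h.int_nonempty.mono interior_subset⟩
  | succ k ih =>
    obtain ⟨S, hS, hS'⟩ := h.exists_similarity t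
    have hcont : Continuous S :=
      (LipschitzWith.of_dist_le_mul (K := ⟨c k, (h.c_pos k).le⟩) fun x y => (hS x y).le).continuous
    rw [hS']
    exact ⟨(ih _).1.image hcont, (ih _).2.image S⟩

theorem volume_interior_pos : 0 < volume.real (interior J) :=
  ENNReal.toReal_pos (isOpen_interior.measure_pos volume h.int_nonempty).ne'
    ((measure_mono interior_subset).trans_lt h.compact.measure_lt_top).ne

theorem sum_volume_interior_le {ι : Type*} {k : ℕ} (s : Finset ι) (f : ι → MoranWord n k)
    (hf : Function.Injective f) {A : Set (EuclideanSpace ℝ (Fin d))} (hA : volume A ≠ ⊤)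
    (hsub : ∀ i ∈ s, interior (Jw (f i).toList) ⊆ A) :
    s.card * (prodC c k ^ d * volume.real (interior J)) ≤ volume.real A := by
  have hdisj : (s : Set ι).PairwiseDisjoint fun i => interior (Jw (f i).toList) :=
    fun i _ j _ hij => h.disjoint_interior (hf.ne hij)
  have hsum := measureReal_biUnion_finset (μ := volume) hdisj
    (fun i _ => isOpen_interior.measurableSet)
    (fun i _ => ((measure_mono interior_subset).trans_lt
      (h.isCompact_nonempty (f i)).1.measure_lt_top).ne)
  simp only [h.volume_interior, Finset.sum_const, nsmul_eq_mul] at hsum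
  rw [← hsum]
  exact measureReal_mono (Set.iUnion₂_subset hsub) hA

theorem mul_pow_le_one (k : ℕ) : n k * c k ^ d ≤ 1 := by
  have hpos : ∀ i, 0 < n i := fun i => zero_lt_two.trans_le (h.two_le_n i)
  let u : MoranWord n k := fun i => ⟨0, hpos i⟩
  let f : Fin (n k) → MoranWord n (k + 1) := fun j => Fin.snoc (α := fun i => Fin (n i)) u j
  have hdrop : ∀ j, (f j).dropLast = u := fun j =>
    funext fun i => Fin.snoc_castSucc (α := fun i => Fin (n i)) j u i
  have hf : Function.Injective f := fun i j hij => by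
    simpa [f] using congrFun hij (Fin.last k)
  have := h.sum_volume_interior_le Finset.univ f hf (A := interior (Jw u.toList))
    ((measure_mono interior_subset).trans_lt (h.isCompact_nonempty u).1.measure_lt_top).ne
    (fun j _ => interior_mono (hdrop j ▸ h.subset_dropLast (f j)))
  rw [h.volume_interior, Finset.card_univ, Fintype.card_fin, prodC_succ, mul_pow] at this
  have hv := mul_pos (pow_pos (h.prodC_pos k) d) h.volume_interior_pos
  refine le_of_mul_le_mul_right ?_ hv
  linarith

theorem dim_ne_zero : d ≠ 0 := by
  rintro rfl
  have := h.mul_pow_le_one 0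
  rw [pow_zero, mul_one] at this
  have h2 := h.two_le_n 0
  have : n 0 ≤ 1 := by exact_mod_cast this
  omega

theorem diam_pos : 0 < Metric.diam J := by
  refine lt_of_le_of_ne Metric.diam_nonneg fun h0 => ?_
  obtain ⟨x, hx⟩ := h.int_nonempty
  have hsub : interior J ⊆ Metric.closedBall x (Metric.diam J) := fun y hy =>
    Metric.dist_le_diam_of_mem h.compact.isBounded (interior_subset hy) (interior_subset hx)
  have := measureReal_mono (μ := volume) hsub measure_closedBall_lt_top.ne
  rw [← h0, Measure.real, Measure.real, Measure.addHaar_closedBall _ _ le_rfl,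
    finrank_euclideanSpace, Fintype.card_fin, zero_pow h.dim_ne_zero] at this
  simp only [ENNReal.ofReal_zero, zero_mul, ENNReal.toReal_zero] at this
  exact this.not_gt h.volume_interior_pos

theorem exists_card_le : ∃ M : ℝ, 1 ≤ M ∧ ∀ (k : ℕ) (s : Finset (MoranWord n k))
    (x : EuclideanSpace ℝ (Fin d)) (r : ℝ), r ≤ prodC c k * Metric.diam J →
    (∀ t ∈ s, (Jw t.toList ∩ Metric.closedBall x r).Nonempty) → (s.card : ℝ) ≤ M := by
  set D := Metric.diam J with hD
  set b := volume.real (Metric.ball (0 : EuclideanSpace ℝ (Fin d)) 1)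
  have hv := h.volume_interior_pos
  refine ⟨max 1 ((2 * D) ^ d * b / volume.real (interior J)), le_max_left _ _,
    fun k s x r hr hs => le_max_of_le_right ?_⟩
  have hC := h.prodC_pos k
  have hD0 : 0 ≤ D := Metric.diam_nonneg
  have hsub : ∀ t ∈ s, interior (Jw t.toList) ⊆ Metric.closedBall x (2 * D * prodC c k) := by
    intro t ht y hy
    obtain ⟨z, hz, hzx⟩ := hs t ht
    have h1 := h.dist_le t (interior_subset hy) hz
    have h2 := dist_triangle y z x
    rw [Metric.mem_closedBall] at hzx ⊢
    linarith
  have := h.sum_volume_interior_le s id Function.injective_id measure_closedBall_lt_top.ne hsub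
  rw [measureReal_def volume (Metric.closedBall _ _), Measure.addHaar_closedBall _ _ (by positivity),
    finrank_euclideanSpace, Fintype.card_fin, ENNReal.toReal_mul,
    ENNReal.toReal_ofReal (by positivity), mul_pow] at this
  rw [le_div_iff₀ hv]
  refine le_of_mul_le_mul_right ?_ (pow_pos hC d)
  change _ ≤ _ * b at this
  linarith

theorem moranSet_subset : moranSet n Jw ⊆ J := by
  rw [moranSet_eq]
  exact (Set.iInter_subset _ 0).trans (Set.iUnion_subset fun t => (h.toList_zero t).subset)

theorem isCompact_moranSet : IsCompact (moranSet n Jw) := by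
  refine h.compact.of_isClosed_subset ?_ h.moranSet_subset
  rw [moranSet_eq]
  exact isClosed_iInter fun k => isClosed_iUnion_of_finite fun t =>
    (h.isCompact_nonempty t).1.isClosed

theorem exists_coding_measure : ∃ P : Measure (∀ i, Fin (n i)), IsProbabilityMeasure P ∧
    ∀ (k : ℕ) (t : MoranWord n k), P.real {σ | ofSeq σ k = t} = (prodN n k : ℝ)⁻¹ := by
  have hn : ∀ i, NeZero (n i) := fun i => ⟨(zero_lt_two.trans_le (h.two_le_n i)).ne'⟩
  refine ⟨Measure.infinitePi fun i => (PMF.uniformOfFintype (Fin (n i))).toMeasure,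
    inferInstance, fun k t => ?_⟩
  let u : ∀ i, Fin (n i) := fun i => if hi : i < k then t ⟨i, hi⟩ else 0
  have hset : {σ : ∀ i, Fin (n i) | ofSeq σ k = t} =
      Set.pi (Finset.range k : Set ℕ) fun i => {u i} := by
    ext σ
    simp only [Set.mem_ofPred_eq, Set.mem_pi, Finset.coe_range, Set.mem_Iio, Set.mem_singleton_iff]
    refine ⟨fun ht i hi => ?_, fun hu => funext fun i => ?_⟩
    · simp only [u, dif_pos hi, ← ht, ofSeq]
    · simp only [ofSeq, hu i i.isLt, u, dif_pos i.isLt]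
  rw [hset, measureReal_def, Measure.infinitePi_pi _ fun i _ => MeasurableSet.singleton _]
  simp only [PMF.toMeasure_apply_singleton _ _ (MeasurableSet.singleton _),
    PMF.uniformOfFintype_apply, Fintype.card_fin, ENNReal.toReal_prod, ENNReal.toReal_inv,
    ENNReal.toReal_natCast, Finset.prod_inv_distrib, prodN, Nat.cast_prod]

theorem two_mul_pow_le_one (k : ℕ) : 2 * c k ^ d ≤ 1 :=
  (mul_le_mul_of_nonneg_right (by exact_mod_cast h.two_le_n k)
    (pow_pos (h.c_pos k) d).le).trans (h.mul_pow_le_one k)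

theorem exists_prodC_add_le {a : ℝ} (ha : 0 < a) : ∃ q, ∀ k, prodC c (k + q) ≤ a * prodC c k := by
  have hpow : ∀ k q, prodC c (k + q) ^ d ≤ (1 / 2) ^ q * prodC c k ^ d := by
    intro k q
    induction q with
    | zero => simp
    | succ q ih =>
      rw [← add_assoc, prodC_succ, mul_pow, pow_succ]
      have hc : c (k + q) ^ d ≤ 1 / 2 := by linarith [h.two_mul_pow_le_one (k + q)]
      calc prodC c (k + q) ^ d * c (k + q) ^ d
          ≤ ((1 / 2) ^ q * prodC c k ^ d) * (1 / 2) :=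
            mul_le_mul ih hc (pow_pos (h.c_pos _) d).le
              (by have := h.prodC_pos k; positivity)
        _ = (1 / 2) ^ q * (1 / 2) * prodC c k ^ d := by ring
  obtain ⟨q, hq⟩ := exists_pow_lt_of_lt_one (pow_pos ha d) (by norm_num : (1 / 2 : ℝ) < 1)
  refine ⟨q, fun k => le_of_pow_le_pow_left₀ h.dim_ne_zero
    (mul_pos ha (h.prodC_pos k)).le ((hpow k q).trans ?_)⟩
  rw [mul_pow]
  exact mul_le_mul_of_nonneg_right hq.le (pow_pos (h.prodC_pos k) d).le

theorem exists_prodC_mul_diam_lt {ε : ℝ} (hε : 0 < ε) : ∃ k, prodC c k * Metric.diam J < ε := by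
  have hD := h.diam_pos
  obtain ⟨q, hq⟩ := h.exists_prodC_add_le (a := ε / (2 * Metric.diam J)) (by positivity)
  refine ⟨q, ?_⟩
  have := hq 0
  rw [zero_add, prodC_zero, mul_one, le_div_iff₀ (by positivity)] at this
  linarith

theorem exists_level {r : ℝ} (hr : 0 < r) (hrD : r ≤ Metric.diam J) :
    ∃ k, prodC c (k + 1) * Metric.diam J < r ∧ r ≤ prodC c k * Metric.diam J := by
  classical
  have hex := h.exists_prodC_mul_diam_lt hr
  have hspec := Nat.find_spec hex
  have h0 : Nat.find hex ≠ 0 := fun h0 => by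
    rw [h0, prodC_zero, one_mul] at hspec
    exact hspec.not_ge hrD
  obtain ⟨k, hk⟩ := Nat.exists_eq_succ_of_ne_zero h0
  rw [hk] at hspec
  exact ⟨k, hspec, not_lt.1 (Nat.find_min hex (hk ▸ Nat.lt_succ_self k))⟩

theorem prodN_pos (k : ℕ) : (0 : ℝ) < prodN n k := by
  exact_mod_cast Finset.prod_pos fun i _ => zero_lt_two.trans_le (h.two_le_n i)

theorem two_pow_mul_prodN_le (k p : ℕ) : (2 : ℝ) ^ p * prodN n k ≤ prodN n (k + p) := by
  induction p with
  | zero => simp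
  | succ p ih =>
    rw [← add_assoc, prodN_succ, Nat.cast_mul, pow_succ, mul_right_comm]
    exact mul_le_mul ih (by exact_mod_cast h.two_le_n _) zero_le_two (h.prodN_pos _).le

theorem prodN_add_le {K : ℝ} (hK : ∀ k, (n k : ℝ) ≤ K) (k p : ℕ) :
    (prodN n (k + p) : ℝ) ≤ K ^ p * prodN n k := by
  have hK0 : 0 ≤ K := (Nat.cast_nonneg _).trans (hK 0)
  induction p with
  | zero => simp
  | succ p ih =>
    have := h.prodN_pos k
    rw [← add_assoc, prodN_succ, Nat.cast_mul, pow_succ, mul_right_comm]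
    exact mul_le_mul ih (hK _) (Nat.cast_nonneg _) (by positivity)

theorem pow_mul_prodC_le {c₀ : ℝ} (hc₀ : 0 < c₀) (hc : ∀ k, c₀ ≤ c k) (k p : ℕ) :
    c₀ ^ p * prodC c k ≤ prodC c (k + p) := by
  induction p with
  | zero => simp
  | succ p ih =>
    rw [← add_assoc, prodC_succ, pow_succ, mul_right_comm]
    exact mul_le_mul ih (hc _) hc₀.le (h.prodC_pos _).le

theorem cast_le_inv_pow {c₀ : ℝ} (hc₀ : 0 < c₀) (hc : ∀ k, c₀ ≤ c k) (k : ℕ) :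
    (n k : ℝ) ≤ (c₀ ^ d)⁻¹ := by
  rw [← one_div, le_div_iff₀ (by positivity)]
  refine le_trans ?_ (h.mul_pow_le_one k)
  have := hc k
  gcongr

theorem log_prodN_le (k : ℕ) : Real.log (prodN n k) ≤ d * -Real.log (prodC c k) := by
  have hle : (prodN n k : ℝ) * prodC c k ^ d ≤ 1 := by
    rw [prodN, prodC, ← Finset.prod_pow, Nat.cast_prod, ← Finset.prod_mul_distrib]
    exact Finset.prod_le_one
      (fun i _ => mul_nonneg (Nat.cast_nonneg _) (pow_pos (h.c_pos i) d).le)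
      fun i _ => h.mul_pow_le_one i
  have hC := pow_pos (h.prodC_pos k) d
  have := Real.log_le_log (mul_pos (h.prodN_pos k) hC) hle
  rw [Real.log_mul (h.prodN_pos k).ne' hC.ne', Real.log_pow, Real.log_one] at this
  linarith

theorem log_prodC_neg (k : ℕ) : Real.log (prodC c (k + 1)) < 0 := by
  refine Real.log_neg (h.prodC_pos _) ?_
  rw [prodC_succ]
  exact mul_lt_one_of_nonneg_of_lt_one_right
    (Finset.prod_le_one (fun i _ => (h.c_pos i).le) fun i _ => (h.c_lt_one i).le)
    (h.c_pos k).le (h.c_lt_one k)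

theorem exists_coding_map : ∃ f : (∀ i, Fin (n i)) → EuclideanSpace ℝ (Fin d), Measurable f ∧
    ∀ σ k, f σ ∈ Jw (ofSeq σ k).toList := by
  have hne : ∀ σ : ∀ i, Fin (n i), (⋂ k, Jw (ofSeq σ k).toList).Nonempty := fun σ =>
    IsCompact.nonempty_iInter_of_sequence_nonempty_isCompact_isClosed _
      (fun k => h.subset_dropLast (ofSeq σ (k + 1))) (fun k => (h.isCompact_nonempty _).2)
      (h.isCompact_nonempty _).1 fun k => (h.isCompact_nonempty _).1.isClosed
  choose f hf using hne
  have hf' : ∀ σ k, f σ ∈ Jw (ofSeq σ k).toList := fun σ => Set.mem_iInter.1 (hf σ)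
  refine ⟨f, Continuous.measurable (continuous_iff_continuousAt.2 fun σ => ?_), hf'⟩
  refine Metric.tendsto_nhds.2 fun ε hε => ?_
  obtain ⟨k, hk⟩ := h.exists_prodC_mul_diam_lt hε
  have hev : ∀ᶠ τ in nhds σ, ∀ i ∈ Finset.range k, τ i = σ i :=
    (Finset.eventually_all _).2 fun i _ =>
      (continuous_apply i).continuousAt.eventually_mem (isOpen_discrete {σ i} |>.mem_nhds rfl)
  filter_upwards [hev] with τ hτ
  have hpre : ofSeq τ k = ofSeq σ k := funext fun i => hτ i (Finset.mem_range.2 i.isLt)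
  exact (h.dist_le (ofSeq σ k) (hpre ▸ hf' τ k) (hf' σ k)).trans_lt hk

theorem exists_measure : ∃ (μ : Measure (EuclideanSpace ℝ (Fin d))) (M : ℝ),
    IsProbabilityMeasure μ ∧ μ (moranSet n Jw)ᶜ = 0 ∧ 1 ≤ M ∧
    (∀ k, ∀ x ∈ moranSet n Jw, ∀ r, prodC c k * Metric.diam J ≤ r →
      (prodN n k : ℝ)⁻¹ ≤ μ.real (Metric.closedBall x r)) ∧
    ∀ k x r, r ≤ prodC c k * Metric.diam J →
      μ.real (Metric.closedBall x r) ≤ M * (prodN n k : ℝ)⁻¹ := by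
  obtain ⟨P, hP, hcyl⟩ := h.exists_coding_measure
  obtain ⟨f, hf, hfmem⟩ := h.exists_coding_map
  obtain ⟨M, hM, hcard⟩ := h.exists_card_le
  have hmap : ∀ x r, (P.map f).real (Metric.closedBall x r) =
      P.real (f ⁻¹' Metric.closedBall x r) := fun x r =>
    map_measureReal_apply hf Metric.isClosed_closedBall.measurableSet
  refine ⟨P.map f, M, Measure.isProbabilityMeasure_map hf.aemeasurable, ?_, hM, ?_, ?_⟩
  · rw [Measure.map_apply hf h.isCompact_moranSet.isClosed.measurableSet.compl, Set.preimage_compl,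
      Set.compl_empty_iff.2, measure_empty]
    refine Set.eq_univ_of_forall fun σ => ?_
    rw [Set.mem_preimage, moranSet_eq]
    exact Set.mem_iInter.2 fun k => Set.mem_iUnion.2 ⟨_, hfmem σ k⟩
  · intro k x hx r hr
    rw [moranSet_eq] at hx
    obtain ⟨t, ht⟩ := Set.mem_iUnion.1 (Set.mem_iInter.1 hx k)
    rw [hmap, ← hcyl k t]
    refine measureReal_mono fun σ hσ => ?_
    exact (h.dist_le t ((show ofSeq σ k = t from hσ) ▸ hfmem σ k) ht).trans hr
  · intro k x r hr
    classical
    let s : Finset (MoranWord n k) := Finset.univ.filter fun t =>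
      (Jw t.toList ∩ Metric.closedBall x r).Nonempty
    have hsub : f ⁻¹' Metric.closedBall x r ⊆ ⋃ t ∈ s, {σ | ofSeq σ k = t} := fun σ hσ => by
      simpa [s] using ⟨f σ, hfmem σ k, hσ⟩
    calc (P.map f).real (Metric.closedBall x r)
        ≤ P.real (⋃ t ∈ s, {σ | ofSeq σ k = t}) := (hmap x r).trans_le 
          (measureReal_mono hsub (measure_ne_top P _))
      _ ≤ ∑ t ∈ s, P.real {σ | ofSeq σ k = t} := measureReal_biUnion_finset_le _ _
      _ = s.card * (prodN n k : ℝ)⁻¹ := by simp only [hcyl, Finset.sum_const, nsmul_eq_mul]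
      _ ≤ M * (prodN n k : ℝ)⁻¹ := by
        gcongr
        exact hcard k s x r hr fun t ht => (Finset.mem_filter.1 ht).2

theorem isHomog {μ : Measure (EuclideanSpace ℝ (Fin d))} [hμ : IsProbabilityMeasure μ] {M : ℝ}
    (hM : 1 ≤ M) (hE : μ (moranSet n Jw)ᶜ = 0)
    (hlow : ∀ k, ∀ x ∈ moranSet n Jw, ∀ r, prodC c k * Metric.diam J ≤ r →
      (prodN n k : ℝ)⁻¹ ≤ μ.real (Metric.closedBall x r))
    (hup : ∀ k x r, r ≤ prodC c k * Metric.diam J →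
      μ.real (Metric.closedBall x r) ≤ M * (prodN n k : ℝ)⁻¹) :
    ∃ lam kappa del Del : ℝ, IsHomog (moranSet n Jw) μ lam kappa del Del := by
  obtain ⟨c₀, hc₀, hc⟩ := h.c_inf_pos
  have hK := h.cast_le_inv_pow hc₀ hc
  set K := (c₀ ^ d)⁻¹
  have hK1 : 1 ≤ K := (by exact_mod_cast one_le_two.trans (h.two_le_n 0) : (1 : ℝ) ≤ n 0).trans
    (hK 0)
  have hMK : 1 ≤ M * K := one_le_mul_of_one_le_of_one_le hM hK1
  have hK0 : 0 < K := zero_lt_one.trans_le hK1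
  have hM0 : 0 < M := zero_lt_one.trans_le hM
  have hD := h.diam_pos
  have hlevel : ∀ r, 0 < r → r ≤ Metric.diam (moranSet n Jw) →
      ∃ k, prodC c (k + 1) * Metric.diam J < r ∧ r ≤ prodC c k * Metric.diam J := fun r hr hrE =>
    h.exists_level hr (hrE.trans (Metric.diam_mono h.moranSet_subset h.compact.isBounded))
  have hN_succ : ∀ k, (prodN n k : ℝ)⁻¹ ≤ K * (prodN n (k + 1) : ℝ)⁻¹ := fun k => by
    rw [← div_eq_mul_inv, le_div_iff₀ (h.prodN_pos _), ← div_eq_inv_mul, div_le_iff₀ (h.prodN_pos _)]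
    simpa using h.prodN_add_le hK k 1
  obtain ⟨p, hp⟩ := pow_unbounded_of_one_lt (2 * (M * K)) (one_lt_two : (1 : ℝ) < 2)
  have hp0 : p ≠ 0 := by
    rintro rfl
    rw [pow_zero] at hp
    linarith
  have hc₀1 : c₀ < 1 := (hc 0).trans_lt (h.c_lt_one 0)
  have hκ : 0 < c₀ ^ p := pow_pos hc₀ p
  obtain ⟨q, hq⟩ := h.exists_prodC_add_le hκ
  refine ⟨M * K, c₀ ^ p, 2, max 2 (M * K ^ (1 + q)), ⟨h.isCompact_moranSet, ?_, hμ, hE, ?_, hMK, ?_,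
    hκ, pow_lt_one₀ hc₀.le hc₀1 hp0, one_lt_two, le_max_left _ _, ?_, ?_⟩⟩
  · refine lt_of_le_of_ne Metric.diam_nonneg fun h0 => ?_
    have hreal : μ.real (moranSet n Jw) = 1 := by
      rw [measureReal_def, (prob_compl_eq_zero_iff h.isCompact_moranSet.measurableSet).1 hE,
        ENNReal.toReal_one]
    obtain ⟨x, hx⟩ : (moranSet n Jw).Nonempty := Set.nonempty_iff_ne_empty.2 fun hem => by
      rw [hem, measureReal_empty] at hreal
      exact zero_ne_one hreal
    have hsub : moranSet n Jw ⊆ Metric.closedBall x 0 := fun y hy => by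
      rw [Metric.mem_closedBall, h0]
      exact Metric.dist_le_diam_of_mem h.isCompact_moranSet.isBounded hy hx
    have h1 := measureReal_mono (μ := μ) hsub
    have h2 := hup p x 0 (mul_nonneg (h.prodC_pos p).le hD.le)
    have h3 := h.two_pow_mul_prodN_le 0 p
    rw [prodN_zero, Nat.cast_one, mul_one, zero_add] at h3
    rw [hreal] at h1
    rw [← div_eq_mul_inv] at h2
    have h4 := (one_le_div (h.prodN_pos p)).1 (h1.trans h2)
    have h5 : M ≤ M * K := le_mul_of_one_le_right hM0.le hK1
    linarith
  · intro x hx r hr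
    obtain ⟨k, hk⟩ := h.exists_prodC_mul_diam_lt hr
    exact (ENNReal.toReal_pos_iff.1
      ((inv_pos.2 (h.prodN_pos k)).trans_le (hlow k x hx r hk.le))).1
  · intro x₁ _ x₂ hx₂ r hr hrE
    obtain ⟨k, hk1, hk⟩ := hlevel r hr hrE
    calc μ.real (Metric.closedBall x₁ r) ≤ M * (prodN n k : ℝ)⁻¹ := hup k x₁ r hk
      _ ≤ M * (K * (prodN n (k + 1) : ℝ)⁻¹) := mul_le_mul_of_nonneg_left (hN_succ k) hM0.le
      _ = M * K * (prodN n (k + 1) : ℝ)⁻¹ := (mul_assoc _ _ _).symm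
      _ ≤ M * K * μ.real (Metric.closedBall x₂ r) :=
        mul_le_mul_of_nonneg_left (hlow _ x₂ hx₂ r hk1.le) (mul_pos hM0 hK0).le
  · intro x hx r hr hrE
    obtain ⟨k, hk1, hk⟩ := hlevel r hr hrE
    have hκr : c₀ ^ p * r ≤ prodC c (k + p) * Metric.diam J :=
      calc c₀ ^ p * r ≤ c₀ ^ p * (prodC c k * Metric.diam J) := mul_le_mul_of_nonneg_left hk hκ.le
        _ = c₀ ^ p * prodC c k * Metric.diam J := (mul_assoc _ _ _).symm
        _ ≤ _ := mul_le_mul_of_nonneg_right (h.pow_mul_prodC_le hc₀ hc k p) hD.le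
    have hN := h.prodN_pos k
    calc 2 * μ.real (Metric.closedBall x (c₀ ^ p * r))
        ≤ 2 * (M * (prodN n (k + p) : ℝ)⁻¹) :=
          mul_le_mul_of_nonneg_left (hup _ x _ hκr) zero_le_two
      _ ≤ 2 * (M * (2 ^ p * prodN n k : ℝ)⁻¹) := by
          gcongr
          exact h.two_pow_mul_prodN_le k p
      _ ≤ 2 * (M * (2 * (M * K) * prodN n k : ℝ)⁻¹) := by gcongr
      _ = (K * prodN n k)⁻¹ := by field_simp
      _ ≤ (prodN n (k + 1) : ℝ)⁻¹ :=
          inv_anti₀ (h.prodN_pos _) (by simpa using h.prodN_add_le hK k 1)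
      _ ≤ _ := hlow _ x hx r hk1.le
  · intro x hx r hr hrE
    obtain ⟨k, hk1, hk⟩ := hlevel r hr hrE
    have hκr : prodC c (k + (1 + q)) * Metric.diam J ≤ c₀ ^ p * r :=
      calc prodC c (k + (1 + q)) * Metric.diam J ≤ c₀ ^ p * prodC c (k + 1) * Metric.diam J := by
            rw [← add_assoc]
            exact mul_le_mul_of_nonneg_right (hq (k + 1)) hD.le
        _ = c₀ ^ p * (prodC c (k + 1) * Metric.diam J) := mul_assoc _ _ _
        _ ≤ _ := mul_le_mul_of_nonneg_left hk1.le hκ.le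
    have hN := h.prodN_pos k
    calc μ.real (Metric.closedBall x r) ≤ M * (prodN n k : ℝ)⁻¹ := hup k x r hk
      _ = M * K ^ (1 + q) * (K ^ (1 + q) * prodN n k : ℝ)⁻¹ := by field_simp
      _ ≤ M * K ^ (1 + q) * (prodN n (k + (1 + q)) : ℝ)⁻¹ :=
          mul_le_mul_of_nonneg_left (inv_anti₀ (h.prodN_pos _) (h.prodN_add_le hK k _))
            (by positivity)
      _ ≤ M * K ^ (1 + q) * μ.real (Metric.closedBall x (c₀ ^ p * r)) :=
          mul_le_mul_of_nonneg_left (hlow _ x hx _ hκr) (by positivity)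
      _ ≤ _ := mul_le_mul_of_nonneg_right (le_max_right _ _) measureReal_nonneg

theorem isAlphaRep {μ : Measure (EuclideanSpace ℝ (Fin d))} [IsProbabilityMeasure μ] {M : ℝ}
    (hM : 1 ≤ M) (hE : μ (moranSet n Jw)ᶜ = 0)
    (hlow : ∀ k, ∀ x ∈ moranSet n Jw, ∀ r, prodC c k * Metric.diam J ≤ r →
      (prodN n k : ℝ)⁻¹ ≤ μ.real (Metric.closedBall x r))
    (hup : ∀ k x r, r ≤ prodC c k * Metric.diam J →
      μ.real (Metric.closedBall x r) ≤ M * (prodN n k : ℝ)⁻¹) {g : ℝ → ℝ}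
    (hg : ∀ k : ℕ, 1 ≤ k → ∀ r : ℝ, prodC c k * Metric.diam J < r →
      r ≤ prodC c (k - 1) * Metric.diam J →
      g r = Real.log (prodN n k : ℝ) / (-Real.log (prodC c k))) :
    IsAlphaRep (moranSet n Jw) μ g := by
  obtain ⟨c₀, hc₀, hc⟩ := h.c_inf_pos
  have hK := h.cast_le_inv_pow hc₀ hc
  set K := (c₀ ^ d)⁻¹
  have hK0 : 0 < K := by positivity
  have hM0 : 0 < M := zero_lt_one.trans_le hM
  have hD := h.diam_pos
  obtain ⟨x, hx⟩ : (moranSet n Jw).Nonempty := Set.nonempty_iff_ne_empty.2 fun hem => by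
    rw [hem, Set.compl_empty, measure_univ] at hE
    exact one_ne_zero hE
  refine ⟨x, hx, |Real.log (M * K)| + d * (|Real.log (Metric.diam J)| + |Real.log c₀|) + 1,
    by positivity, min 1 (Metric.diam J), lt_min one_pos hD, fun r hr hr1 => ?_⟩
  obtain ⟨k, hk1, hk⟩ := h.exists_level hr (hr1.le.trans (min_le_right _ _))
  rw [hg (k + 1) (Nat.le_add_left _ _) r hk1 hk]
  have hN := h.prodN_pos (k + 1)
  have hC := h.prodC_pos (k + 1)
  have hlogr : Real.log r < 0 := Real.log_neg hr (hr1.trans_le (min_le_left _ _))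
  have hlogC := h.log_prodC_neg k
  have hlogN := h.log_prodN_le (k + 1)
  have hlogN0 : 0 ≤ Real.log (prodN n (k + 1)) := Real.log_natCast_nonneg _
  have hν := hlow _ x hx r hk1.le
  have hν' : μ.real (Metric.closedBall x r) ≤ M * K * (prodN n (k + 1) : ℝ)⁻¹ := by
    refine (hup k x r hk).trans ?_
    rw [mul_assoc]
    refine mul_le_mul_of_nonneg_left ?_ hM0.le
    rw [← div_eq_mul_inv, le_div_iff₀ hN, ← div_eq_inv_mul, div_le_iff₀ (h.prodN_pos _)]
    simpa using h.prodN_add_le hK k 1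
  have hνpos := (inv_pos.2 hN).trans_le hν
  have hlogν := Real.log_le_log (inv_pos.2 hN) hν
  have hlogν' := Real.log_le_log hνpos hν'
  rw [Real.log_inv] at hlogν
  rw [Real.log_mul (by positivity) (by positivity), Real.log_inv] at hlogν'
  have hr_low := Real.log_le_log (by positivity) hk1.le
  rw [Real.log_mul hC.ne' hD.ne'] at hr_low
  have hr_up : Real.log (r * c₀) ≤ Real.log (prodC c (k + 1) * Metric.diam J) := by
    refine Real.log_le_log (by positivity) ?_
    rw [prodC_succ, mul_right_comm]
    exact mul_le_mul hk (hc k) hc₀.le (mul_pos (h.prodC_pos k) hD).le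
  rw [Real.log_mul hr.ne' hc₀.ne', Real.log_mul hC.ne' hD.ne'] at hr_up
  have key : alphaPt μ x r - Real.log (prodN n (k + 1)) / -Real.log (prodC c (k + 1)) =
      ((Real.log (μ.real (Metric.closedBall x r)) + Real.log (prodN n (k + 1))) +
        Real.log (prodN n (k + 1)) / Real.log (prodC c (k + 1)) *
          (Real.log r - Real.log (prodC c (k + 1)))) / Real.log r := by
    rw [alphaPt, ← measureReal_def]
    field_simp [hlogr.ne, hlogC.ne]
    ring
  rw [key, abs_div]
  refine div_le_div_of_nonneg_right ?_ (abs_nonneg _)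
  refine (abs_add_le _ _).trans ?_
  have h1 : |Real.log (μ.real (Metric.closedBall x r)) + Real.log (prodN n (k + 1))| ≤
      |Real.log (M * K)| := by
    rw [abs_of_nonneg (by linarith)]
    linarith [le_abs_self (Real.log (M * K))]
  have h2 : |Real.log (prodN n (k + 1)) / Real.log (prodC c (k + 1))| ≤ d := by
    rw [abs_div, abs_of_nonneg hlogN0, abs_of_neg hlogC, div_le_iff₀ (neg_pos.2 hlogC)]
    exact hlogN
  have h3 : |Real.log r - Real.log (prodC c (k + 1))| ≤
      |Real.log (Metric.diam J)| + |Real.log c₀| := by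
    rw [abs_le]
    constructor <;> linarith [le_abs_self (Real.log (Metric.diam J)), abs_nonneg (Real.log c₀),
      neg_abs_le (Real.log (Metric.diam J)), neg_abs_le (Real.log c₀)]
  rw [abs_mul]
  linarith [mul_le_mul h2 h3 (abs_nonneg _) (Nat.cast_nonneg d)]

end IsMoranSystem

/-- Every Moran set is homogeneous; moreover one can take
`α_E(r) = log(n₁⋯n_k)/(−log(c₁⋯c_k))` for `(c₁⋯c_k)|J| < r ≤ (c₁⋯c_{k−1})|J|`. -/
theorem statement5 {d : ℕ} (J : Set (EuclideanSpace ℝ (Fin d))) (n : ℕ → ℕ) (c : ℕ → ℝ)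
    (Jw : List ℕ → Set (EuclideanSpace ℝ (Fin d))) (h : IsMoranSystem J n c Jw) :
    ∃ (μ : Measure (EuclideanSpace ℝ (Fin d))) (lam kappa del Del : ℝ),
      IsHomog (moranSet n Jw) μ lam kappa del Del ∧
      ∀ g : ℝ → ℝ,
        (∀ k : ℕ, 1 ≤ k → ∀ r : ℝ, prodC c k * Metric.diam J < r →
          r ≤ prodC c (k - 1) * Metric.diam J →
          g r = Real.log (prodN n k : ℝ) / (-Real.log (prodC c k))) →
        IsAlphaRep (moranSet n Jw) μ g := by
  obtain ⟨μ, M, hμ, hE, hM, hlow, hup⟩ := h.exists_measure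
  obtain ⟨lam, kappa, del, Del, hhom⟩ := h.isHomog hM hE hlow hup
  exact ⟨μ, lam, kappa, del, Del, hhom, fun g hg => h.isAlphaRep hM hE hlow hup hg⟩

end
end
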